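/- Let Ω^j be a sequence of domains in ℂⁿ converging to a domain Ω_∞ ⊂ ℂⁿ in the local Hausdorff sense, such that K_{Ω^j}(z,z) > 0 on Ω^j and K_{Ω_∞}(z,z) > 0 on Ω_∞, and K_{Ω^j}(z,z) → K_{Ω_∞}(z,z) for every z ∈ Ω_∞. Then for all indices μ, ν = 1, …, n, the Bergman metric tensors g^{Ω^j}_{μν} converge to g^{Ω_∞}_{μν} as j → ∞ uniformly on compact subsets of Ω_∞, together with all partial derivatives. -/

import Mathlib

open MeasureTheory Metric Filter Topology Set
open scoped ENNReal

noncomputable section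

/-- Membership in the Bergman space `A²(Ω)`: holomorphic and square-integrable. -/
def MemA2 {n : ℕ} (Ω : Set (Fin n → ℂ)) (f : (Fin n → ℂ) → ℂ) : Prop :=
  DifferentiableOn ℂ f Ω ∧ MemLp f 2 (volume.restrict Ω)

/-- `K` is the Bergman kernel of `Ω`: the reproducing kernel of `A²(Ω)`. -/
def IsBergmanKernel {n : ℕ} (Ω : Set (Fin n → ℂ)) (K : (Fin n → ℂ) → (Fin n → ℂ) → ℂ) : Prop :=
  (∀ w ∈ Ω, MemA2 Ω fun z => K z w) ∧
  ∀ f, MemA2 Ω f → ∀ w ∈ Ω, f w = ∫ z in Ω, f z * (starRingEnd ℂ) (K z w)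

/-- Wirtinger derivative `∂f/∂z_μ`. -/
def wderiv {n : ℕ} (μ : Fin n) (f : (Fin n → ℂ) → ℂ) (z : Fin n → ℂ) : ℂ :=
  (fderiv ℝ f z (Pi.single μ 1) - Complex.I * fderiv ℝ f z (Pi.single μ Complex.I)) / 2

/-- Wirtinger derivative `∂f/∂z̄_μ`. -/
def wderivBar {n : ℕ} (μ : Fin n) (f : (Fin n → ℂ) → ℂ) (z : Fin n → ℂ) : ℂ :=
  (fderiv ℝ f z (Pi.single μ 1) + Complex.I * fderiv ℝ f z (Pi.single μ Complex.I)) / 2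

/-- One-variable Wirtinger derivative `∂f/∂z`. -/
def wderiv1 (f : ℂ → ℂ) (z : ℂ) : ℂ :=
  (fderiv ℝ f z 1 - Complex.I * fderiv ℝ f z Complex.I) / 2

/-- One-variable Wirtinger derivative `∂f/∂z̄`. -/
def wderiv1Bar (f : ℂ → ℂ) (z : ℂ) : ℂ :=
  (fderiv ℝ f z 1 + Complex.I * fderiv ℝ f z Complex.I) / 2

/-- Bergman metric tensor `g_{μν}(z) = ∂² log K(z,z) / ∂z_μ ∂z̄_ν`. -/
def bergmanTensor {n : ℕ} (K : (Fin n → ℂ) → (Fin n → ℂ) → ℂ) (μ ν : Fin n)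
    (z : Fin n → ℂ) : ℂ :=
  wderiv μ (fun w => wderivBar ν (fun u => Complex.log (K u u)) w) z

/-- The hermitian quadratic form of the Bergman metric. -/
def bergmanQuad {n : ℕ} (K : (Fin n → ℂ) → (Fin n → ℂ) → ℂ) (z ξ : Fin n → ℂ) : ℝ :=
  (∑ μ, ∑ ν, bergmanTensor K μ ν z * ξ μ * (starRingEnd ℂ) (ξ ν)).re

/-- The Bergman metric `b_Ω(z,ξ)`. -/
def bergmanMetric {n : ℕ} (K : (Fin n → ℂ) → (Fin n → ℂ) → ℂ) (z ξ : Fin n → ℂ) : ℝ :=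
  Real.sqrt (bergmanQuad K z ξ)

/-- Piecewise-`C¹` curves on `[0,1]`. -/
def PiecewiseC1 {n : ℕ} (γ : ℝ → (Fin n → ℂ)) : Prop :=
  ContinuousOn γ (Set.Icc 0 1) ∧
  ∃ (k : ℕ) (t : Fin (k + 1) → ℝ), StrictMono t ∧ t 0 = 0 ∧ t (Fin.last k) = 1 ∧
    ∀ i : Fin k, ContDiffOn ℝ 1 γ (Set.Icc (t i.castSucc) (t i.succ))

/-- The Bergman length of a curve. -/
def bergmanLength {n : ℕ} (K : (Fin n → ℂ) → (Fin n → ℂ) → ℂ) (γ : ℝ → (Fin n → ℂ)) : ℝ :=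
  ∫ t in (0:ℝ)..1, bergmanMetric K (γ t) (deriv γ t)

/-- The Bergman pseudodistance of `Ω`. -/
def bergmanDist {n : ℕ} (Ω : Set (Fin n → ℂ)) (K : (Fin n → ℂ) → (Fin n → ℂ) → ℂ)
    (z w : Fin n → ℂ) : ℝ :=
  sInf { L : ℝ | ∃ γ : ℝ → (Fin n → ℂ), γ 0 = z ∧ γ 1 = w ∧
    (∀ t ∈ Set.Icc (0:ℝ) 1, γ t ∈ Ω) ∧ PiecewiseC1 γ ∧ L = bergmanLength K γ }

/-- The Bergman ball `B_Ω(p,r)`. -/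
def bergmanBall {n : ℕ} (Ω : Set (Fin n → ℂ)) (K : (Fin n → ℂ) → (Fin n → ℂ) → ℂ)
    (p : Fin n → ℂ) (r : ℝ) : Set (Fin n → ℂ) :=
  { z ∈ Ω | bergmanDist Ω K p z < r }

/-- The Bergman pseudodistance is an honest distance. -/
def BergmanDistIsDistance {n : ℕ} (Ω : Set (Fin n → ℂ))
    (K : (Fin n → ℂ) → (Fin n → ℂ) → ℂ) : Prop :=
  ∀ z ∈ Ω, ∀ w ∈ Ω, z ≠ w → 0 < bergmanDist Ω K z w

/-- `Ω` is complete with respect to the Bergman distance. -/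
def BergmanComplete {n : ℕ} (Ω : Set (Fin n → ℂ))
    (K : (Fin n → ℂ) → (Fin n → ℂ) → ℂ) : Prop :=
  ∀ x : ℕ → (Fin n → ℂ), (∀ k, x k ∈ Ω) →
    (∀ ε : ℝ, 0 < ε → ∃ N, ∀ k ≥ N, ∀ l ≥ N, bergmanDist Ω K (x k) (x l) < ε) →
    ∃ p ∈ Ω, Filter.Tendsto (fun k => bergmanDist Ω K (x k) p) Filter.atTop (nhds 0)

/-- The Euclidean unit ball `𝔹ⁿ ⊂ ℂⁿ`. -/
def euclUnitBall (n : ℕ) : Set (Fin n → ℂ) :=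
  { z | ∑ μ, ‖z μ‖ ^ 2 < 1 }

/-- The Bergman–Fridman invariant `h_X(p)`. -/
def fridmanInv {n : ℕ} (Ω : Set (Fin n → ℂ)) (K : (Fin n → ℂ) → (Fin n → ℂ) → ℂ)
    (p : Fin n → ℂ) : ℝ :=
  sInf { c : ℝ | ∃ r : ℝ, 0 < r ∧ c = 1 / r ∧ ∃ f : (Fin n → ℂ) → (Fin n → ℂ),
    DifferentiableOn ℂ f (euclUnitBall n) ∧ Set.InjOn f (euclUnitBall n) ∧
    f '' euclUnitBall n ⊆ Ω ∧ bergmanBall Ω K p r ⊆ f '' euclUnitBall n }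

/-- Biholomorphic equivalence of domains in `ℂⁿ` (an injective holomorphic map of `ℂⁿ`
restricted to a domain is automatically a biholomorphism onto its image). -/
def Biholomorphic {n : ℕ} (U V : Set (Fin n → ℂ)) : Prop :=
  ∃ f : (Fin n → ℂ) → (Fin n → ℂ),
    DifferentiableOn ℂ f U ∧ Set.InjOn f U ∧ f '' U = V

/-- The Levi form of a real-valued function `ρ` at `p` in direction `ξ`. -/
def leviForm {n : ℕ} (ρ : (Fin n → ℂ) → ℝ) (p ξ : Fin n → ℂ) : ℝ :=
  (∑ μ, ∑ ν, wderiv μ (fun w => wderivBar ν (fun u => (ρ u : ℂ)) w) p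
      * ξ μ * (starRingEnd ℂ) (ξ ν)).re

/-- The complex tangent space of `{ρ = 0}` at `p`. -/
def complexTangent {n : ℕ} (ρ : (Fin n → ℂ) → ℝ) (p : Fin n → ℂ) : Set (Fin n → ℂ) :=
  { ξ | ∑ μ, wderiv μ (fun u => (ρ u : ℂ)) p * ξ μ = 0 }

/-- Strong pseudoconvexity at a boundary point, for defining function `ρ`. -/
def StronglyPseudoconvexAt {n : ℕ} (ρ : (Fin n → ℂ) → ℝ) (p : Fin n → ℂ) : Prop :=
  ∀ ξ ∈ complexTangent ρ p, ξ ≠ 0 → 0 < leviForm ρ p ξ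

/-- `ρ` is a (global) defining function for `D`. -/
def IsDefiningFunction {n : ℕ} (D : Set (Fin n → ℂ)) (ρ : (Fin n → ℂ) → ℝ) : Prop :=
  (∀ z, z ∈ D ↔ ρ z < 0) ∧ ∀ z ∈ frontier D, fderiv ℝ ρ z ≠ 0

/-- Plurisubharmonicity via the sub-mean-value property on complex lines. -/
def PlurisubharmonicOn {n : ℕ} (u : (Fin n → ℂ) → ℝ) (Ω : Set (Fin n → ℂ)) : Prop :=
  UpperSemicontinuousOn u Ω ∧
  ∀ (a b : Fin n → ℂ) (r : ℝ), 0 < r →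
    (∀ w : ℂ, ‖w‖ ≤ r → a + w • b ∈ Ω) →
    u a ≤ (1 / (2 * Real.pi)) *
      ∫ θ in (0:ℝ)..(2 * Real.pi), u (a + ((r : ℂ) * Complex.exp (θ * Complex.I)) • b)

/-- Pseudoconvexity: `-log dist(·, ∂D)` is plurisubharmonic on `D`. -/
def IsPseudoconvex {n : ℕ} (D : Set (Fin n → ℂ)) : Prop :=
  PlurisubharmonicOn (fun z => -Real.log (Metric.infDist z Dᶜ)) D

/-- Order of vanishing at `0` of a vector-valued map on `ℂ` (`⊤` if it vanishes to
infinite order). -/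
def vanishingOrderC {n : ℕ} (f : ℂ → (Fin n → ℂ)) : ℝ≥0∞ :=
  sInf ((fun m : ℕ => (m : ℝ≥0∞)) '' { m : ℕ | iteratedDeriv m f 0 ≠ 0 })

/-- Order of vanishing at `0` of a real-valued function on `ℂ`. -/
def vanishingOrderR (g : ℂ → ℝ) : ℝ≥0∞ :=
  sInf ((fun m : ℕ => (m : ℝ≥0∞)) '' { m : ℕ | iteratedFDeriv ℝ m g 0 ≠ 0 })

/-- The D'Angelo 1-type of `ρ` at `p`. -/
def dAngeloOneType {n : ℕ} (ρ : (Fin n → ℂ) → ℝ) (p : Fin n → ℂ) : ℝ≥0∞ :=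
  ⨆ (φ : ℂ → (Fin n → ℂ)) (_ : AnalyticAt ℂ φ 0) (_ : φ 0 = p)
    (_ : vanishingOrderC (fun w => φ w - p) ≠ ⊤),
    vanishingOrderR (fun w => ρ (φ w)) / vanishingOrderC (fun w => φ w - p)

/-- The Levi form at `p` has at most one degenerate eigenvalue. -/
def LeviCorankOneAt {n : ℕ} (ρ : (Fin n → ℂ) → ℝ) (p : Fin n → ℂ) : Prop :=
  ∃ V : Submodule ℂ (Fin n → ℂ), n - 2 ≤ Module.finrank ℂ V ∧
    (V : Set (Fin n → ℂ)) ⊆ complexTangent ρ p ∧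
    ∀ ξ ∈ V, ξ ≠ 0 → 0 < leviForm ρ p ξ

/-- A bounded smooth pseudoconvex finite-type Levi corank one domain, with defining
function `ρ`. -/
def IsLeviCorankOneDomain {n : ℕ} (D : Set (Fin n → ℂ)) (ρ : (Fin n → ℂ) → ℝ) : Prop :=
  IsOpen D ∧ IsConnected D ∧ Bornology.IsBounded D ∧ IsPseudoconvex D ∧
  ContDiff ℝ (⊤ : ℕ∞) ρ ∧ IsDefiningFunction D ρ ∧
  (∀ p ∈ frontier D, dAngeloOneType ρ p ≠ ⊤) ∧
  ∀ p ∈ frontier D, LeviCorankOneAt ρ p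

/-- The open unit disc in `ℂ`. -/
def openUnitDisc : Set ℂ := Metric.ball 0 1

/-- Tautness of a domain in `ℂⁿ`. -/
def IsTaut {n : ℕ} (D : Set (Fin n → ℂ)) : Prop :=
  ∀ f : ℕ → ℂ → (Fin n → ℂ),
    (∀ k, DifferentiableOn ℂ (f k) openUnitDisc ∧ f k '' openUnitDisc ⊆ D) →
    ∃ φ : ℕ → ℕ, StrictMono φ ∧
      ((∃ g : ℂ → (Fin n → ℂ), DifferentiableOn ℂ g openUnitDisc ∧ g '' openUnitDisc ⊆ D ∧
          TendstoLocallyUniformlyOn (fun k => f (φ k)) g Filter.atTop openUnitDisc) ∨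
        ∀ S : Set ℂ, IsCompact S → S ⊆ openUnitDisc →
          ∀ L : Set (Fin n → ℂ), IsCompact L → L ⊆ D →
            ∀ᶠ k in Filter.atTop, ∀ w ∈ S, f (φ k) w ∉ L)

/-- Convergence of a sequence of domains in the local Hausdorff sense. -/
def LocalHausdorffConv {n : ℕ} (Ω : ℕ → Set (Fin n → ℂ)) (Ωl : Set (Fin n → ℂ)) : Prop :=
  (∀ S : Set (Fin n → ℂ), IsCompact S → S ⊆ Ωl → ∀ᶠ j in Filter.atTop, S ⊆ Ω j) ∧
  ∀ S : Set (Fin n → ℂ), IsCompact S →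
    (∃ j₀ : ℕ, S ⊆ interior (⋂ j, ⋂ (_ : j₀ ≤ j), Ω j)) → S ⊆ Ωl

/-- A real-valued subharmonic polynomial of degree at most `d` in one complex variable,
containing no harmonic terms. -/
def SubharmonicPolyNoHarm (P : ℂ → ℝ) (d : ℕ) : Prop :=
  (∃ c : Fin (d + 1) → Fin (d + 1) → ℂ,
    (∀ j, c j 0 = 0) ∧ (∀ k, c 0 k = 0) ∧
    ∀ w : ℂ, (P w : ℂ) = ∑ j, ∑ k, c j k * w ^ (j : ℕ) * (starRingEnd ℂ) w ^ (k : ℕ)) ∧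
  ∀ w : ℂ, 0 ≤ (wderiv1 (fun u => wderiv1Bar (fun v => (P v : ℂ)) u) w).re

/-- A strictly subharmonic real polynomial of degree `2` in one complex variable. -/
def StrictlySubharmonicPolyDeg2 (Q : ℂ → ℝ) : Prop :=
  (∃ c : Fin 3 → Fin 3 → ℂ, ∀ w : ℂ,
      (Q w : ℂ) = ∑ j, ∑ k, c j k * w ^ (j : ℕ) * (starRingEnd ℂ) w ^ (k : ℕ)) ∧
  ∀ w : ℂ, 0 < (wderiv1 (fun u => wderiv1Bar (fun v => (Q v : ℂ)) u) w).re

/-- A nontangential cone in `D` with vertex `p0 ∈ ∂D`. -/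
def IsNontangentialCone {n : ℕ} (D Γ : Set (Fin n → ℂ)) (p0 : Fin n → ℂ) : Prop :=
  Γ ⊆ D ∧ p0 ∈ closure Γ ∧
  ∃ C : ℝ, 0 < C ∧ ∀ z ∈ Γ, ‖z - p0‖ ≤ C * Metric.infDist z Dᶜ

/-- The Bergman kernel is positive on the diagonal of `Ω`. -/
def DiagPos {n : ℕ} (Ω : Set (Fin n → ℂ)) (K : (Fin n → ℂ) → (Fin n → ℂ) → ℂ) : Prop :=
  ∀ z ∈ Ω, (K z z).im = 0 ∧ 0 < (K z z).re

/-- The Bergman metric of `Ω` is positive definite. -/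
def BergPosDef {n : ℕ} (Ω : Set (Fin n → ℂ)) (K : (Fin n → ℂ) → (Fin n → ℂ) → ℂ) : Prop :=
  ∀ z ∈ Ω, ∀ ξ : Fin n → ℂ, ξ ≠ 0 → 0 < bergmanMetric K z ξ

/-- The real coordinate directions of `ℂⁿ ≃ ℝ^{2n}`. -/
def realDir {n : ℕ} (μ : Fin (2 * n)) : Fin n → ℂ :=
  Pi.single ⟨(μ : ℕ) / 2, by have := μ.isLt; omega⟩
    (if (μ : ℕ) % 2 = 0 then 1 else Complex.I)

/-- The real coefficients `g̃_{μν}` of the Bergman metric, obtained by polarization. -/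
def realTensor {n : ℕ} (K : (Fin n → ℂ) → (Fin n → ℂ) → ℂ) (μ ν : Fin (2 * n))
    (z : Fin n → ℂ) : ℝ :=
  (bergmanQuad K z (realDir μ + realDir ν) - bergmanQuad K z (realDir μ)
    - bergmanQuad K z (realDir ν)) / 2

/-- The Christoffel symbols `Γ^η_{μν}` of the Bergman metric, in real coordinates. -/
def christoffel {n : ℕ} (K : (Fin n → ℂ) → (Fin n → ℂ) → ℂ) (η μ ν : Fin (2 * n))
    (z : Fin n → ℂ) : ℝ :=
  (1 / 2) * ∑ τ : Fin (2 * n),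
    (fderiv ℝ (realTensor K ν τ) z (realDir μ)
      + fderiv ℝ (realTensor K τ μ) z (realDir ν)
      - fderiv ℝ (realTensor K μ ν) z (realDir τ))
    * (Matrix.of fun a b => realTensor K a b z)⁻¹ τ η

/-- `z0 ∈ ∂D` is a local holomorphic peak point of `D`. -/
def IsLocalPeakPoint {n : ℕ} (D : Set (Fin n → ℂ)) (z0 : Fin n → ℂ) : Prop :=
  ∃ U ∈ nhds z0, ∃ g : (Fin n → ℂ) → ℂ,
    DifferentiableOn ℂ g (U ∩ D) ∧ ContinuousOn g (closure (U ∩ D)) ∧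
    g z0 = 1 ∧ ∀ z ∈ closure (U ∩ D), z ≠ z0 → ‖g z‖ < 1

/-- A real polynomial on `ℂⁿ` containing no pluriharmonic terms. -/
def IsPolyNoPluriharm {n : ℕ} (P : (Fin n → ℂ) → ℝ) : Prop :=
  ∃ (d : ℕ) (c : (Fin n → Fin (d + 1)) → (Fin n → Fin (d + 1)) → ℂ),
    (∀ α β, (∀ j, (β j : ℕ) = 0) → c α β = 0) ∧
    (∀ α β, (∀ j, (α j : ℕ) = 0) → c α β = 0) ∧
    ∀ z, (P z : ℂ) = ∑ α, ∑ β, c α β * (∏ j, z j ^ (α j : ℕ)) *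
      ∏ j, (starRingEnd ℂ) (z j) ^ (β j : ℕ)


/-- The family `F` of maps, parametrized by a topological space, is of class `C^m` in the space
variable near `(x₀, z₀)`, with derivatives of order at most `m` jointly continuous at `(x₀, z₀)`. -/
def SmoothFamilyAt {X E : Type} [TopologicalSpace X] [NormedAddCommGroup E] [NormedSpace ℝ E]
    (x₀ : X) (z₀ : E) : ℕ → ∀ {G : Type} [NormedAddCommGroup G] [NormedSpace ℝ G],
      (X → E → G) → Prop
  | 0, _, _, _, F => ContinuousAt (fun p : X × E => F p.1 p.2) (x₀, z₀)
  | m + 1, _, _, _, F => ContinuousAt (fun p : X × E => F p.1 p.2) (x₀, z₀) ∧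
      (∀ᶠ p : X × E in 𝓝 (x₀, z₀), DifferentiableAt ℝ (F p.1) p.2) ∧
      SmoothFamilyAt x₀ z₀ m (fun x => fderiv ℝ (F x))

theorem eventually_eventuallyEq_prod {X E G : Type*} [TopologicalSpace X] [TopologicalSpace E]
    {x₀ : X} {z₀ : E} {F F' : X → E → G}
    (h : ∀ᶠ p : X × E in 𝓝 (x₀, z₀), F p.1 p.2 = F' p.1 p.2) :
    ∀ᶠ p : X × E in 𝓝 (x₀, z₀), F p.1 =ᶠ[𝓝 p.2] F' p.1 := by
  filter_upwards [eventually_eventually_nhds.2 h] with p hp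
  have : ContinuousAt (fun z : E => (p.1, z)) p.2 := by fun_prop
  exact this.eventually hp

namespace SmoothFamilyAt

variable {X E : Type} [TopologicalSpace X] [NormedAddCommGroup E] [NormedSpace ℝ E]
  {x₀ : X} {z₀ : E} {G G₁ G₂ : Type} [NormedAddCommGroup G] [NormedSpace ℝ G]
  [NormedAddCommGroup G₁] [NormedSpace ℝ G₁] [NormedAddCommGroup G₂] [NormedSpace ℝ G₂]

theorem continuousAt {m : ℕ} {F : X → E → G} (h : SmoothFamilyAt x₀ z₀ m F) :
    ContinuousAt (fun p : X × E => F p.1 p.2) (x₀, z₀) := by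
  cases m with
  | zero => exact h
  | succ m => exact h.1

theorem of_succ {m : ℕ} {F : X → E → G} (h : SmoothFamilyAt x₀ z₀ (m + 1) F) :
    SmoothFamilyAt x₀ z₀ m F := by
  induction m generalizing G with
  | zero => exact h.1
  | succ m ih => exact ⟨h.1, h.2.1, ih h.2.2⟩

theorem congr {m : ℕ} {F F' : X → E → G} (h : SmoothFamilyAt x₀ z₀ m F)
    (heq : ∀ᶠ p : X × E in 𝓝 (x₀, z₀), F p.1 p.2 = F' p.1 p.2) :
    SmoothFamilyAt x₀ z₀ m F' := by
  induction m generalizing G with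
  | zero => exact ContinuousAt.congr h heq
  | succ m ih =>
    have hev := eventually_eventuallyEq_prod heq
    refine ⟨ContinuousAt.congr h.1 heq, ?_, ih h.2.2 ?_⟩
    · filter_upwards [h.2.1, hev] with p hp hpe
      exact hp.congr_of_eventuallyEq hpe.symm
    · filter_upwards [hev] with p hp
      exact hp.fderiv_eq

theorem succ_of_hasFDerivAt {m : ℕ} {F : X → E → G} {F' : X → E → E →L[ℝ] G}
    (hc : ContinuousAt (fun p : X × E => F p.1 p.2) (x₀, z₀))
    (hd : ∀ᶠ p : X × E in 𝓝 (x₀, z₀), HasFDerivAt (F p.1) (F' p.1 p.2) p.2)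
    (h : SmoothFamilyAt x₀ z₀ m F') : SmoothFamilyAt x₀ z₀ (m + 1) F :=
  ⟨hc, hd.mono fun _ hp => hp.differentiableAt, h.congr (hd.mono fun _ hp => hp.fderiv.symm)⟩

theorem clm_comp {m : ℕ} {F : X → E → G} (h : SmoothFamilyAt x₀ z₀ m F) (L : G →L[ℝ] G₁) :
    SmoothFamilyAt x₀ z₀ m (fun x z => L (F x z)) := by
  induction m generalizing G G₁ with
  | zero => exact L.continuous.continuousAt.comp (f := fun p : X × E => F p.1 p.2) h
  | succ m ih =>
    exact succ_of_hasFDerivAt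
      (L.continuous.continuousAt.comp (f := fun p : X × E => F p.1 p.2) h.1)
      (F' := fun x z => L.comp (fderiv ℝ (F x) z))
      (h.2.1.mono fun p hp => L.hasFDerivAt.comp p.2 hp.hasFDerivAt)
      (ih h.2.2 (ContinuousLinearMap.compL ℝ E G G₁ L))

theorem add {m : ℕ} {F F' : X → E → G} (h : SmoothFamilyAt x₀ z₀ m F)
    (h' : SmoothFamilyAt x₀ z₀ m F') : SmoothFamilyAt x₀ z₀ m (fun x z => F x z + F' x z) := by
  induction m generalizing G with
  | zero => exact ContinuousAt.add h h'
  | succ m ih =>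
    refine succ_of_hasFDerivAt (ContinuousAt.add h.1 h'.1) ?_ (ih h.2.2 h'.2.2)
    filter_upwards [h.2.1, h'.2.1] with p hp hp'
    exact hp.hasFDerivAt.add hp'.hasFDerivAt

theorem bilinear {m : ℕ} {F : X → E → G} {F' : X → E → G₁} (h : SmoothFamilyAt x₀ z₀ m F)
    (h' : SmoothFamilyAt x₀ z₀ m F') (B : G →L[ℝ] G₁ →L[ℝ] G₂) :
    SmoothFamilyAt x₀ z₀ m (fun x z => B (F x z) (F' x z)) := by
  have hB : ∀ {F : X → E → G} {F' : X → E → G₁},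
      ContinuousAt (fun p : X × E => F p.1 p.2) (x₀, z₀) →
      ContinuousAt (fun p : X × E => F' p.1 p.2) (x₀, z₀) →
      ContinuousAt (fun p : X × E => B (F p.1 p.2) (F' p.1 p.2)) (x₀, z₀) := fun h h' =>
    (B.continuous.continuousAt.comp h).clm_apply h'
  induction m generalizing G G₁ G₂ with
  | zero => exact hB h h'
  | succ m ih =>
    refine succ_of_hasFDerivAt (F' := fun x z => B.precompR E (F x z) (fderiv ℝ (F' x) z) +
        B.precompL E (fderiv ℝ (F x) z) (F' x z)) (hB h.1 h'.1) ?_ (add ?_ ?_)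
    · filter_upwards [h.2.1, h'.2.1] with p hp hp'
      exact B.hasFDerivAt_of_bilinear hp.hasFDerivAt hp'.hasFDerivAt
    · exact ih h.of_succ h'.2.2 _ fun h h' =>
        ((B.precompR E).continuous.continuousAt.comp h).clm_apply h'
    · exact ih h.2.2 h'.of_succ _ fun h h' =>
        ((B.precompL E).continuous.continuousAt.comp h).clm_apply h'

theorem inv {m : ℕ} {F : X → E → ℂ} (h : SmoothFamilyAt x₀ z₀ m F) (h0 : F x₀ z₀ ≠ 0) :
    SmoothFamilyAt x₀ z₀ m (fun x z => (F x z)⁻¹) := by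
  induction m with
  | zero => exact ContinuousAt.inv₀ h h0
  | succ m ih =>
    have hi := ih h.of_succ
    have hne := h.1.eventually_ne h0
    refine succ_of_hasFDerivAt (F' := fun x z => -(((F x z)⁻¹ * (F x z)⁻¹) • fderiv ℝ (F x) z))
      (ContinuousAt.inv₀ h.1 h0) ?_ ?_
    · filter_upwards [h.2.1, hne] with p hp hp0
      have := (hasDerivAt_inv hp0).comp_hasFDerivAt_of_eq (𝕜 := ℝ) p.2 hp.hasFDerivAt rfl
      refine HasFDerivAt.congr_fderiv this ?_
      rw [pow_two, mul_inv]
      exact neg_smul _ _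
    · exact ((hi.bilinear hi (ContinuousLinearMap.mul ℝ ℂ)).bilinear h.2.2
        (-(ContinuousLinearMap.lsmul ℝ ℂ : ℂ →L[ℝ] (E →L[ℝ] ℂ) →L[ℝ] (E →L[ℝ] ℂ))))

theorem clog {m : ℕ} {F : X → E → ℂ} (h : SmoothFamilyAt x₀ z₀ m F)
    (h0 : F x₀ z₀ ∈ Complex.slitPlane) :
    SmoothFamilyAt x₀ z₀ m (fun x z => Complex.log (F x z)) := by
  cases m with
  | zero => exact ContinuousAt.clog h h0
  | succ m =>
    refine succ_of_hasFDerivAt (F' := fun x z => (F x z)⁻¹ • fderiv ℝ (F x) z)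
      (ContinuousAt.clog h.1 h0) ?_ ?_
    · filter_upwards [h.2.1, h.1.eventually_mem (Complex.isOpen_slitPlane.mem_nhds h0)] with p hp hp0
      exact (Complex.hasStrictDerivAt_log hp0).hasDerivAt.comp_hasFDerivAt p.2 hp.hasFDerivAt
    · exact (h.of_succ.inv (Complex.slitPlane_ne_zero h0)).bilinear h.2.2
        (ContinuousLinearMap.lsmul ℝ ℂ)

theorem continuousAt_iteratedFDeriv {m : ℕ} {F : X → E → G} (h : SmoothFamilyAt x₀ z₀ m F) :
    ContinuousAt (fun p : X × E => iteratedFDeriv ℝ m (F p.1) p.2) (x₀, z₀) := by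
  induction m generalizing G with
  | zero =>
    simp only [iteratedFDeriv_zero_eq_comp]
    exact (continuousMultilinearCurryFin0 ℝ E G).symm.continuous.continuousAt.comp
      (f := fun p : X × E => F p.1 p.2) h
  | succ m ih =>
    simp only [iteratedFDeriv_succ_eq_comp_right]
    exact (continuousMultilinearCurryRightEquiv' ℝ m E G).symm.continuous.continuousAt.comp
      (ih h.2.2)

end SmoothFamilyAt

theorem hasFDerivAt_integral_of_bounded {E Y G : Type} [NormedAddCommGroup E] [NormedSpace ℝ E]
    [ProperSpace E] [NormedAddCommGroup Y] [NormedSpace ℝ Y] [ProperSpace Y] [MeasurableSpace Y]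
    [BorelSpace Y] [NormedAddCommGroup G] [NormedSpace ℝ G] [NormedSpace ℂ G]
    [IsScalarTower ℝ ℂ G] [SMulCommClass ℝ ℂ G]
    {μ : Measure Y} [IsFiniteMeasure μ] {R C : ℝ} (hμ : ∀ᵐ y ∂μ, ‖y‖ ≤ R) {k : Y → ℂ}
    (hkm : AEStronglyMeasurable k μ) (hkC : ∀ᵐ y ∂μ, ‖k y‖ ≤ C) {Φ : E × Y → G}
    (hΦ : ContDiff ℝ 1 Φ) (z : E) :
    HasFDerivAt (fun z => ∫ y, k y • Φ (z, y) ∂μ)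
      (∫ y, k y • (fderiv ℝ Φ (z, y)).comp (ContinuousLinearMap.inl ℝ E Y) ∂μ) z := by
  have hcont : Continuous Φ := hΦ.continuous
  have hΦ' : Continuous fun p => (fderiv ℝ Φ p).comp (ContinuousLinearMap.inl ℝ E Y) := by
    have := hΦ.continuous_fderiv one_ne_zero
    fun_prop
  have hK := (isCompact_closedBall z 1).prod (isCompact_closedBall (0 : Y) R)
  obtain ⟨M, hM⟩ := hK.exists_bound_of_continuousOn hΦ'.continuousOn
  obtain ⟨M', hM'⟩ := hK.exists_bound_of_continuousOn hcont.continuousOn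
  refine hasFDerivAt_integral_of_dominated_of_fderiv_le (𝕜 := ℝ) (bound := fun _ => C * M)
    (closedBall_mem_nhds z one_pos) (.of_forall fun w => hkm.smul (by fun_prop : Continuous fun y => Φ (w, y)).aestronglyMeasurable)
    ?_ (F' := fun w y => k y • (fderiv ℝ Φ (w, y)).comp (ContinuousLinearMap.inl ℝ E Y))
    (hkm.smul (hΦ'.comp (by fun_prop : Continuous fun y => (z, y))).aestronglyMeasurable)
    ?_ (integrable_const _) (.of_forall fun y w _ => ?_)
  · refine Integrable.of_bound (C := C * M') (hkm.smul (by fun_prop : Continuous fun y => Φ (z, y)).aestronglyMeasurable) ?_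
    filter_upwards [hμ, hkC] with y hy hk
    rw [norm_smul]
    exact mul_le_mul hk (hM' (z, y) ⟨mem_closedBall_self zero_le_one, by simpa using hy⟩)
      (norm_nonneg _) ((norm_nonneg _).trans hk)
  · filter_upwards [hμ, hkC] with y hy hk w hw
    rw [norm_smul]
    exact mul_le_mul hk (hM (w, y) ⟨hw, by simpa using hy⟩) (norm_nonneg _)
      ((norm_nonneg _).trans hk)
  · refine HasFDerivAt.const_smul ?_ (k y)
    exact (hΦ.differentiable one_ne_zero (w, y)).hasFDerivAt.comp w (hasFDerivAt_prodMk_left w y)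

theorem continuousAt_integral_of_bounded {X E Y G : Type} [TopologicalSpace X]
    [FirstCountableTopology X] [NormedAddCommGroup E]
    [ProperSpace E] [NormedAddCommGroup Y] [ProperSpace Y] [MeasurableSpace Y]
    [BorelSpace Y] [NormedAddCommGroup G] [NormedSpace ℝ G] [NormedSpace ℂ G]
    {μ : Measure Y} [IsFiniteMeasure μ] {R C : ℝ} (hμ : ∀ᵐ y ∂μ, ‖y‖ ≤ R) {x₀ : X} {k : X → Y → ℂ}
    (hkm : ∀ᶠ x in 𝓝 x₀, AEStronglyMeasurable (k x) μ)
    (hkC : ∀ᶠ x in 𝓝 x₀, ∀ᵐ y ∂μ, ‖k x y‖ ≤ C)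
    (hkt : ∀ᵐ y ∂μ, ContinuousAt (fun x => k x y) x₀) {Φ : E × Y → G}
    (hΦ : Continuous Φ) (z : E) :
    ContinuousAt (fun p : X × E => ∫ y, k p.1 y • Φ (p.2, y) ∂μ) (x₀, z) := by
  have hK := (isCompact_closedBall z 1).prod (isCompact_closedBall (0 : Y) R)
  obtain ⟨M, hM⟩ := hK.exists_bound_of_continuousOn hΦ.continuousOn
  have h1 : Tendsto (Prod.fst : X × E → X) (𝓝 (x₀, z)) (𝓝 x₀) := continuous_fst.continuousAt
  have h2 : Tendsto (Prod.snd : X × E → E) (𝓝 (x₀, z)) (𝓝 z) := continuous_snd.continuousAt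
  refine tendsto_integral_filter_of_dominated_convergence (fun _ => C * M) ?_ ?_
    (integrable_const _) ?_
  · filter_upwards [h1.eventually hkm] with p hp
    exact hp.smul (by fun_prop : Continuous fun y => Φ (p.2, y)).aestronglyMeasurable
  · filter_upwards [h1.eventually hkC, h2.eventually (closedBall_mem_nhds z one_pos)] with p hp hpz
    filter_upwards [hμ, hp] with y hy hk
    rw [norm_smul]
    exact mul_le_mul hk (hM (p.2, y) ⟨hpz, by simpa using hy⟩)
      (norm_nonneg _) ((norm_nonneg _).trans hk)
  · filter_upwards [hkt] with y hy
    refine Tendsto.smul (hy.tendsto.comp h1) ?_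
    exact (by fun_prop : Continuous fun p : X × E => Φ (p.2, y)).continuousAt

theorem SmoothFamilyAt.integral {X E Y G : Type} [TopologicalSpace X]
    [FirstCountableTopology X] [NormedAddCommGroup E] [NormedSpace ℝ E]
    [ProperSpace E] [NormedAddCommGroup Y] [NormedSpace ℝ Y] [ProperSpace Y] [MeasurableSpace Y]
    [BorelSpace Y] [NormedAddCommGroup G] [NormedSpace ℝ G] [NormedSpace ℂ G]
    [IsScalarTower ℝ ℂ G] [SMulCommClass ℝ ℂ G]
    {μ : Measure Y} [IsFiniteMeasure μ] {R C : ℝ} (hμ : ∀ᵐ y ∂μ, ‖y‖ ≤ R) {x₀ : X} {k : X → Y → ℂ}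
    (hkm : ∀ᶠ x in 𝓝 x₀, AEStronglyMeasurable (k x) μ)
    (hkC : ∀ᶠ x in 𝓝 x₀, ∀ᵐ y ∂μ, ‖k x y‖ ≤ C)
    (hkt : ∀ᵐ y ∂μ, ContinuousAt (fun x => k x y) x₀) {Φ : E × Y → G}
    (hΦ : ContDiff ℝ (⊤ : ℕ∞) Φ) (z₀ : E) (m : ℕ) :
    SmoothFamilyAt x₀ z₀ m (fun x z => ∫ y, k x y • Φ (z, y) ∂μ) := by
  induction m generalizing G with
  | zero => exact continuousAt_integral_of_bounded hμ hkm hkC hkt hΦ.continuous z₀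
  | succ m ih =>
    refine SmoothFamilyAt.succ_of_hasFDerivAt
      (continuousAt_integral_of_bounded hμ hkm hkC hkt hΦ.continuous z₀)
      (F' := fun x z => ∫ y, k x y •
        (fderiv ℝ Φ (z, y)).comp (ContinuousLinearMap.inl ℝ E Y) ∂μ) ?_
      (ih (Φ := fun p => (fderiv ℝ Φ p).comp (ContinuousLinearMap.inl ℝ E Y)) ?_)
    · have h1 : Tendsto (Prod.fst : X × E → X) (𝓝 (x₀, z₀)) (𝓝 x₀) := continuous_fst.continuousAt
      filter_upwards [h1.eventually hkm, h1.eventually hkC] with p hp hpC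
      exact hasFDerivAt_integral_of_bounded hμ hp hpC (hΦ.of_le (by exact_mod_cast le_top)) p.2
    · exact (hΦ.fderiv_right (m := (⊤ : ℕ∞)) (by simp)).clm_comp contDiff_const

theorem measurePreserving_unit_smul {n : ℕ} {c : ℂ} (hc : ‖c‖ = 1) :
    MeasurePreserving (fun u : Fin n → ℂ => c • u) volume volume :=
  volume_preserving_pi (f := fun (_ : Fin n) (w : ℂ) => c • w) fun _ =>
    (rotation ⟨c, by simp [Submonoid.unitSphere, hc]⟩).measurePreserving

theorem setIntegral_closedBall_unit_smul {n : ℕ} {c : ℂ} (hc : ‖c‖ = 1) (r : ℝ)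
    (g : (Fin n → ℂ) → ℂ) :
    ∫ u in closedBall 0 r, g (c • u) = ∫ u in closedBall 0 r, g u := by
  have hc0 : c ≠ 0 := norm_ne_zero_iff.1 (by simp [hc])
  have h := (measurePreserving_unit_smul (n := n) hc).setIntegral_preimage_emb
    (Homeomorph.smulOfNeZero c hc0).measurableEmbedding g (closedBall 0 r)
  rw [← h]
  congr 2
  ext u
  simp [norm_smul, hc]

theorem integral_mul_rotationInvariant {n : ℕ} {Ω : Set (Fin n → ℂ)}
    {f : (Fin n → ℂ) → ℂ} (hf : DifferentiableOn ℂ f Ω) {z : Fin n → ℂ} {r : ℝ}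
    (hr : closedBall z r ⊆ Ω) {φ : (Fin n → ℂ) → ℂ} (hφ : Continuous φ)
    (hφr : ∀ (c : ℂ) u, ‖c‖ = 1 → φ (c • u) = φ u) :
    ∫ u in closedBall 0 r, f (z + u) * φ u = f z * ∫ u in closedBall 0 r, φ u := by
  have hmem : ∀ {t : ℂ} {u : Fin n → ℂ}, ‖t‖ ≤ 1 → u ∈ closedBall (0 : Fin n → ℂ) r →
      z + t • u ∈ Ω := fun {t u} ht hu => hr <| by
    rw [mem_closedBall, dist_self_add_left, norm_smul]
    have : ‖u‖ ≤ r := by simpa using hu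
    nlinarith [norm_nonneg u]
  have hrot : ∀ θ : ℝ, ∫ u in closedBall 0 r, f (z + circleMap 0 1 θ • u) * φ u =
      ∫ u in closedBall 0 r, f (z + u) * φ u := fun θ => by
    have hθ : ‖circleMap 0 1 θ‖ = 1 := by simp
    rw [← setIntegral_closedBall_unit_smul hθ r (fun u => f (z + u) * φ u)]
    simp only [hφr _ _ hθ]
  have hmean : ∀ u ∈ closedBall (0 : Fin n → ℂ) r,
      ∫ θ in (0)..(2 * Real.pi), f (z + circleMap 0 1 θ • u) = 2 * Real.pi * f z := fun u hu => by
    have hd : DifferentiableOn ℂ (fun t : ℂ => f (z + t • u)) (closedBall 0 1) :=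
      hf.comp (by fun_prop) fun t ht => hmem (by simpa using ht) hu
    have h := DiffContOnCl.circleAverage (f := fun t : ℂ => f (z + t • u)) (c := 0) (R := 1)
      (by rw [abs_one]; exact (hd.mono closure_ball_subset_closedBall).diffContOnCl)
    rw [Real.circleAverage_def] at h
    have hpi : (Real.pi : ℂ) ≠ 0 := by exact_mod_cast Real.pi_ne_zero
    simp only [zero_smul, add_zero, Complex.real_smul] at h
    rw [← h]
    push_cast
    field_simp
  have hpi : (2 * Real.pi : ℂ) ≠ 0 := by exact_mod_cast Real.two_pi_pos.ne'
  have hint : IntegrableOn (fun p : ℝ × (Fin n → ℂ) => f (z + circleMap 0 1 p.1 • p.2) * φ p.2)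
      (Icc 0 (2 * Real.pi) ×ˢ closedBall 0 r) (volume.prod volume) := by
    refine ContinuousOn.integrableOn_compact (isCompact_Icc.prod (isCompact_closedBall _ _)) ?_
    refine ContinuousOn.mul (hf.continuousOn.comp ?_ fun p hp => hmem (by simp) hp.2) ?_
    · have := continuous_circleMap 0 1
      fun_prop
    · fun_prop
  have hswap : ∫ θ in (0)..(2 * Real.pi), ∫ u in closedBall 0 r, f (z + circleMap 0 1 θ • u) * φ u =
      ∫ u in closedBall 0 r, ∫ θ in (0)..(2 * Real.pi), f (z + circleMap 0 1 θ • u) * φ u := by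
    simp only [intervalIntegral.integral_of_le Real.two_pi_pos.le]
    refine integral_integral_swap ?_
    rw [Measure.prod_restrict]
    exact hint.mono_set (prod_mono_left Ioc_subset_Icc_self)
  simp only [hrot, intervalIntegral.integral_const, intervalIntegral.integral_mul_const] at hswap
  have hcongr : ∫ u in closedBall 0 r,
      (∫ θ in (0)..(2 * Real.pi), f (z + circleMap 0 1 θ • u)) * φ u =
      ∫ u in closedBall 0 r, (2 * Real.pi * f z) * φ u :=
    setIntegral_congr_fun measurableSet_closedBall fun u hu => by simp only [hmean u hu]
  rw [hcongr, integral_const_mul, Complex.real_smul] at hswap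
  push_cast at hswap
  rw [sub_zero, mul_assoc (2 * (Real.pi : ℂ))] at hswap
  exact mul_left_cancel₀ hpi hswap

/-- Existence of a smooth rotation-invariant mollifier at scale `r` reproducing holomorphic
functions. -/
theorem exists_reproducing_mollifier (n : ℕ) {r : ℝ} (hr : 0 < r) :
    ∃ φ : (Fin n → ℂ) → ℂ, ContDiff ℝ (⊤ : ℕ∞) φ ∧ HasCompactSupport φ ∧
      ∀ (Ω : Set (Fin n → ℂ)) (f : (Fin n → ℂ) → ℂ),
      DifferentiableOn ℂ f Ω → ∀ z, closedBall z r ⊆ Ω →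
        ∀ B : Set (Fin n → ℂ), MeasurableSet B → closedBall z r ⊆ B →
          f z = ∫ u in B, f u * φ (u - z) := by
  set ψ : (Fin n → ℂ) → ℝ := fun u => Real.smoothTransition (r ^ 2 - ∑ i, ‖u i‖ ^ 2) with hψ
  have hψc : ContDiff ℝ (⊤ : ℕ∞) ψ := by
    refine Real.smoothTransition.contDiff.comp (contDiff_const.sub (ContDiff.sum fun i _ => ?_))
    exact (contDiff_apply ℝ ℂ i).norm_sq ℝ
  have hψ0 : ∀ u, u ∉ closedBall (0 : Fin n → ℂ) r → ψ u = 0 := fun u hu => by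
    refine Real.smoothTransition.zero_of_nonpos (sub_nonpos.2 ?_)
    by_contra! h
    refine hu (mem_closedBall_zero_iff.2 ((pi_norm_le_iff_of_nonneg hr.le).2 fun i => ?_))
    have : ‖u i‖ ^ 2 ≤ ∑ i, ‖u i‖ ^ 2 :=
      Finset.single_le_sum (f := fun i => ‖u i‖ ^ 2) (fun _ _ => by positivity) (Finset.mem_univ i)
    exact (abs_le_of_sq_le_sq' (this.trans h.le) hr.le).2
  have hψr : ∀ (c : ℂ) u, ‖c‖ = 1 → ψ (c • u) = ψ u := fun c u hc => by
    simp [hψ, hc]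
  have hpos : 0 < ∫ u, ψ u := by
    refine hψc.continuous.integral_pos_of_hasCompactSupport_nonneg_nonzero (x := 0)
      (HasCompactSupport.intro (isCompact_closedBall 0 r) hψ0)
      (fun u => Real.smoothTransition.nonneg _) ?_
    have : 0 < r ^ 2 := by positivity
    simpa [hψ] using (Real.smoothTransition.pos_of_pos this).ne'
  set I : ℝ := ∫ u, ψ u with hI
  have hI0 : (I : ℂ) ≠ 0 := by exact_mod_cast hpos.ne'
  refine ⟨fun u => (I : ℂ)⁻¹ * ψ u,
    contDiff_const.mul (Complex.ofRealCLM.contDiff.comp hψc),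
    HasCompactSupport.intro (isCompact_closedBall 0 r) fun u hu => by simp [hψ0 u hu], ?_⟩
  intro Ω f hf z hz B hB hzB
  have hIc : ∫ u, (ψ u : ℂ) = I := integral_complex_ofReal
  beta_reduce
  have h := integral_mul_rotationInvariant hf hz (φ := fun u => (ψ u : ℂ))
    (Complex.continuous_ofReal.comp hψc.continuous) fun c u hc => by simp only [hψr c u hc]
  rw [setIntegral_eq_integral_of_forall_compl_eq_zero (fun u hu => by simp [hψ0 u hu]),
    setIntegral_eq_integral_of_forall_compl_eq_zero (fun u hu => by simp [hψ0 u hu]),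
    hIc] at h
  rw [setIntegral_eq_integral_of_forall_compl_eq_zero, ← integral_add_left_eq_self _ z]
  · simp only [add_sub_cancel_left]
    calc f z = (I : ℂ)⁻¹ * (f z * I) := by field_simp
      _ = _ := by
        rw [← h, ← integral_const_mul]
        congr 1 with u
        ring
  · intro u hu
    rw [hψ0 (u - z) fun h => hu (hzB (by simpa [dist_eq_norm] using h))]
    simp

section Kernel

variable {n : ℕ} {Ω : Set (Fin n → ℂ)} {K : (Fin n → ℂ) → (Fin n → ℂ) → ℂ}

/-- The kernel function `K(·, w)` as an element of `L²(Ω)`. -/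
def IsBergmanKernel.toLp (hK : IsBergmanKernel Ω K) {w : Fin n → ℂ} (hw : w ∈ Ω) :
    Lp ℂ 2 (volume.restrict Ω) :=
  (hK.1 w hw).2.toLp _

theorem IsBergmanKernel.eq_inner (hK : IsBergmanKernel Ω K) {f : (Fin n → ℂ) → ℂ}
    (hf : MemA2 Ω f) {w : Fin n → ℂ} (hw : w ∈ Ω) :
    f w = inner ℂ (hK.toLp hw) (hf.2.toLp f) := by
  rw [hK.2 f hf w hw, L2.inner_def]
  refine integral_congr_ae ?_
  filter_upwards [(hK.1 w hw).2.coeFn_toLp, hf.2.coeFn_toLp] with z h₁ h₂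
  rw [IsBergmanKernel.toLp, h₁, h₂, RCLike.inner_apply]

theorem IsBergmanKernel.eq_inner_toLp (hK : IsBergmanKernel Ω K) {z w : Fin n → ℂ}
    (hz : z ∈ Ω) (hw : w ∈ Ω) : K z w = inner ℂ (hK.toLp hz) (hK.toLp hw) :=
  hK.eq_inner (hK.1 w hw) hz

theorem IsBergmanKernel.conj_symm (hK : IsBergmanKernel Ω K) {z w : Fin n → ℂ}
    (hz : z ∈ Ω) (hw : w ∈ Ω) : (starRingEnd ℂ) (K w z) = K z w := by
  rw [hK.eq_inner_toLp hz hw, hK.eq_inner_toLp hw hz, inner_conj_symm]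

theorem IsBergmanKernel.diag_eq (hK : IsBergmanKernel Ω K) {w : Fin n → ℂ} (hw : w ∈ Ω) :
    K w w = ((‖hK.toLp hw‖ ^ 2 : ℝ) : ℂ) := by
  rw [hK.eq_inner_toLp hw hw, inner_self_eq_norm_sq_to_K]
  norm_cast

theorem IsBergmanKernel.norm_le (hK : IsBergmanKernel Ω K) {z w : Fin n → ℂ}
    (hz : z ∈ Ω) (hw : w ∈ Ω) : ‖K z w‖ ≤ ‖hK.toLp hz‖ * ‖hK.toLp hw‖ := by
  rw [hK.eq_inner_toLp hz hw]
  exact norm_inner_le_norm _ _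

theorem IsBergmanKernel.eq_of_norm_le (hK : IsBergmanKernel Ω K) {f : (Fin n → ℂ) → ℂ}
    (hf : MemA2 Ω f) {w : Fin n → ℂ} (hw : w ∈ Ω) (hfw : f w = K w w)
    (hn : ‖hf.2.toLp f‖ ≤ ‖hK.toLp hw‖) {z : Fin n → ℂ} (hz : z ∈ Ω) : f z = K z w := by
  have h : hf.2.toLp f = hK.toLp hw := by
    rw [← sub_eq_zero, ← norm_eq_zero, ← sq_eq_zero_iff]
    have h₁ : RCLike.re (inner ℂ (hf.2.toLp f) (hK.toLp hw)) = ‖hK.toLp hw‖ ^ 2 := by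
      rw [inner_re_symm, ← hK.eq_inner hf hw, hfw, hK.diag_eq hw]
      exact Complex.ofReal_re _
    have h₂ := norm_sub_sq (𝕜 := ℂ) (hf.2.toLp f) (hK.toLp hw)
    rw [h₁] at h₂
    have := pow_le_pow_left₀ (norm_nonneg _) hn 2
    exact le_antisymm (by linarith) (sq_nonneg _)
  rw [hK.eq_inner hf hz, h, ← hK.eq_inner_toLp hz hw]

end Kernel

/-- The kernel is bounded at a fixed distance to the boundary, uniformly over all open sets. -/
theorem exists_forall_norm_toLp_le (n : ℕ) {r : ℝ} (hr : 0 < r) :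
    ∃ C : ℝ, ∀ (Ω : Set (Fin n → ℂ)) (_ : MeasurableSet Ω) (K : (Fin n → ℂ) → (Fin n → ℂ) → ℂ)
      (hK : IsBergmanKernel Ω K) (w : Fin n → ℂ) (hw : w ∈ Ω), closedBall w r ⊆ Ω →
        ‖hK.toLp hw‖ ≤ C := by
  obtain ⟨φ, hφ, hφc, hrep⟩ := exists_reproducing_mollifier n hr
  have hφL : MemLp φ 2 volume := hφ.continuous.memLp_of_hasCompactSupport hφc
  refine ⟨(eLpNorm φ 2 volume).toReal, fun Ω hΩ K hK w hw hball => ?_⟩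
  have hmp : MeasurePreserving (fun u : Fin n → ℂ => u - w) volume volume :=
    measurePreserving_sub_right volume w
  have hg : MemLp (fun u => (starRingEnd ℂ) (φ (u - w))) 2 (volume.restrict Ω) :=
    ((hφL.comp_measurePreserving hmp).star).restrict Ω
  have hgn : ‖hg.toLp _‖ ≤ (eLpNorm φ 2 volume).toReal := by
    rw [Lp.norm_toLp]
    refine ENNReal.toReal_mono hφL.eLpNorm_ne_top ?_
    calc _ = eLpNorm (φ ∘ fun u => u - w) 2 (volume.restrict Ω) :=
          eLpNorm_congr_norm_ae (.of_forall fun u => by simp)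
      _ ≤ eLpNorm (φ ∘ fun u => u - w) 2 volume := eLpNorm_restrict_le _ _ _ _
      _ = _ := eLpNorm_comp_measurePreserving hφL.1 hmp
  have h : K w w = inner ℂ (hg.toLp _) (hK.toLp hw) := by
    rw [hrep Ω _ (hK.1 w hw).1 w hball Ω hΩ hball, L2.inner_def]
    refine integral_congr_ae ?_
    filter_upwards [(hK.1 w hw).2.coeFn_toLp, hg.coeFn_toLp] with z h₁ h₂
    rw [IsBergmanKernel.toLp, h₁, h₂, RCLike.inner_apply, Complex.conj_conj]
  have h' := norm_inner_le_norm (𝕜 := ℂ) (hg.toLp _) (hK.toLp hw)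
  rw [← h, hK.diag_eq hw, Complex.norm_real, Real.norm_of_nonneg (by positivity), sq] at h'
  rcases (norm_nonneg (hK.toLp hw)).eq_or_lt with h0 | h0
  · rw [← h0]
    exact ENNReal.toReal_nonneg
  · exact (le_of_mul_le_mul_right h' h0).trans hgn

section Holomorphic

variable {E : Type*} [NormedAddCommGroup E] [NormedSpace ℂ E]

/-- Cauchy estimate for the derivative of a bounded holomorphic function. -/
theorem norm_fderiv_le_of_norm_le_on_ball {f : E → ℂ} {c : E} {R M : ℝ} (hR : 0 < R)
    (hf : DifferentiableOn ℂ f (ball c R)) (hM : ∀ x ∈ ball c R, ‖f x‖ ≤ M) :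
    ‖fderiv ℂ f c‖ ≤ 2 * M / R := by
  refine Complex.norm_fderiv_le_div_of_mapsTo_ball hf (fun x hx => ?_) hR
  rw [mem_closedBall, dist_eq_norm]
  linarith [norm_sub_le (f x) (f c), hM x hx, hM c (mem_ball_self hR)]

theorem norm_fderiv_le_of_norm_le_on_ball_of_mem {f : E → ℂ} {c : E} {R M : ℝ}
    (hf : DifferentiableOn ℂ f (ball c (2 * R))) (hM : ∀ x ∈ ball c (2 * R), ‖f x‖ ≤ M)
    {x : E} (hx : x ∈ ball c R) : ‖fderiv ℂ f x‖ ≤ 2 * M / R :=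
  have hsub : ball x R ⊆ ball c (2 * R) := ball_subset_ball' (by
    rw [mem_ball] at hx
    linarith)
  norm_fderiv_le_of_norm_le_on_ball (pos_of_mem_ball hx) (hf.mono hsub) fun y hy => hM y (hsub hy)

theorem norm_sub_le_of_norm_le_on_ball {f : E → ℂ} {c : E} {R M : ℝ}
    (hf : DifferentiableOn ℂ f (ball c (2 * R))) (hM : ∀ x ∈ ball c (2 * R), ‖f x‖ ≤ M)
    {x y : E} (hx : x ∈ ball c R) (hy : y ∈ ball c R) :
    ‖f y - f x‖ ≤ 2 * M / R * ‖y - x‖ := by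
  have hR := pos_of_mem_ball hx
  refine (convex_ball c R).norm_image_sub_le_of_norm_fderiv_le (𝕜 := ℂ) (fun z hz => ?_)
    (fun z hz => norm_fderiv_le_of_norm_le_on_ball_of_mem hf hM hz) hx hy
  exact hf.differentiableAt (isOpen_ball.mem_nhds (ball_subset_ball (by linarith) hz))

variable {ι : Type*} {l : Filter ι} [l.NeBot] {F : ι → E → ℂ} {f : E → ℂ} {U : Set E}

/-- Montel-type statement: pointwise convergence of locally bounded holomorphic functions is
locally uniform. -/
theorem tendstoLocallyUniformlyOn_of_locally_bounded
    (hF : ∀ z ∈ U, ∃ r > 0, ∃ M : ℝ, ∀ᶠ j in l, DifferentiableOn ℂ (F j) (ball z r) ∧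
      ∀ x ∈ ball z r, ‖F j x‖ ≤ M)
    (hf : ∀ z ∈ U, Tendsto (fun j => F j z) l (𝓝 (f z))) :
    TendstoLocallyUniformlyOn F f l U := by
  rw [Metric.tendstoLocallyUniformlyOn_iff]
  intro ε hε x hx
  obtain ⟨r, hr, M, h⟩ := hF x hx
  set L := 2 * max M 0 / (r / 2)
  have hL0 : 0 ≤ L := by positivity
  have hL : ∀ᶠ j in l, ∀ y ∈ ball x (r / 2), ‖F j y - F j x‖ ≤ L * ‖y - x‖ := by
    filter_upwards [h] with j hj y hy
    have hrr : 2 * (r / 2) = r := by ring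
    exact norm_sub_le_of_norm_le_on_ball (R := r / 2) (by rw [hrr]; exact hj.1)
      (by rw [hrr]; exact fun z hz => (hj.2 z hz).trans (le_max_left _ _))
      (mem_ball_self (by positivity)) hy
  set δ := min (r / 2) (ε / (4 * (L + 1)))
  have hδ : 0 < δ := by positivity
  have hLδ : L * δ ≤ ε / 4 := by
    calc L * δ ≤ (L + 1) * (ε / (4 * (L + 1))) := by gcongr; linarith; exact min_le_right _ _
      _ = ε / 4 := by field_simp
  have hsmall : ∀ᶠ j in l, ∀ y ∈ ball x δ, ‖F j y - F j x‖ ≤ ε / 4 := by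
    filter_upwards [hL] with j hj y hy
    refine (hj y (ball_subset_ball (min_le_left _ _) hy)).trans (le_trans ?_ hLδ)
    gcongr
    rw [← dist_eq_norm]
    exact (mem_ball.1 hy).le
  refine ⟨ball x δ ∩ U, inter_mem (mem_nhdsWithin_of_mem_nhds (ball_mem_nhds x hδ))
    self_mem_nhdsWithin, ?_⟩
  filter_upwards [hsmall, (Metric.tendsto_nhds.1 (hf x hx)) (ε / 4) (by positivity)]
    with j hj hjx y hy
  have hfy : ‖f y - f x‖ ≤ ε / 4 :=
    le_of_tendsto ((hf y hy.2).sub (hf x hx)).norm (hsmall.mono fun j hj => hj y hy.1)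
  rw [dist_eq_norm] at hjx ⊢
  calc ‖f y - F j y‖ = ‖(f y - f x) - (F j y - F j x) - (F j x - f x)‖ := by congr 1; ring
    _ ≤ ‖f y - f x‖ + ‖F j y - F j x‖ + ‖F j x - f x‖ :=
      (norm_sub_le _ _).trans (add_le_add_left (norm_sub_le _ _) _)
    _ < ε := by linarith [hj y hy.1]

/-- Weierstrass: a locally uniform limit of holomorphic functions of several variables is
holomorphic. -/
theorem differentiableOn_of_tendstoLocallyUniformlyOn [LocallyCompactSpace E] (hU : IsOpen U)
    (hF : ∀ z ∈ U, ∃ r > 0, ∀ᶠ j in l, DifferentiableOn ℂ (F j) (ball z r))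
    (hf : TendstoLocallyUniformlyOn F f l U) : DifferentiableOn ℂ f U := by
  intro x hx
  refine DifferentiableAt.differentiableWithinAt ?_
  obtain ⟨r, hr, hd⟩ := hF x hx
  obtain ⟨s, hs, hsU, hsc⟩ := local_compact_nhds (hU.mem_nhds hx)
  have hunif := (tendstoLocallyUniformlyOn_iff_tendstoUniformlyOn_of_compact hsc).1 (hf.mono hsU)
  obtain ⟨ρ, hρ, hρs⟩ := Metric.mem_nhds_iff.1 (inter_mem hs (ball_mem_nhds x hr))
  obtain ⟨R, hR, rfl⟩ : ∃ R > 0, 2 * R = ρ := ⟨ρ / 2, by positivity, by ring⟩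
  have hdR : ∀ᶠ j in l, DifferentiableOn ℂ (F j) (ball x (2 * R)) :=
    hd.mono fun j hj => hj.mono (hρs.trans inter_subset_right)
  have hdat : ∀ {j}, DifferentiableOn ℂ (F j) (ball x (2 * R)) → ∀ y ∈ ball x R,
      DifferentiableAt ℂ (F j) y := fun hj y hy =>
    hj.differentiableAt (isOpen_ball.mem_nhds (ball_subset_ball (by linarith) hy))
  have hcauchy : UniformCauchySeqOn (fun j => fderiv ℂ (F j)) l (ball x R) := by
    intro u hu
    obtain ⟨ε, hε, hεu⟩ := Metric.mem_uniformity_dist.1 hu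
    have hη : ∀ᶠ j in l, DifferentiableOn ℂ (F j) (ball x (2 * R)) ∧
        ∀ y ∈ s, dist (f y) (F j y) < ε * R / 8 :=
      hdR.and (Metric.tendstoUniformlyOn_iff.1 hunif _ (by positivity))
    filter_upwards [hη.prod_mk hη] with p hp y hy
    refine hεu ?_
    rw [dist_eq_norm, ← fderiv_sub (hdat hp.1.1 y hy) (hdat hp.2.1 y hy)]
    refine (norm_fderiv_le_of_norm_le_on_ball_of_mem (M := ε * R / 4) (hp.1.1.sub hp.2.1)
      (fun z hz => ?_) hy).trans_lt ?_
    · have h₁ := hp.1.2 z (hρs hz).1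
      have h₂ := hp.2.2 z (hρs hz).1
      rw [Pi.sub_apply, ← dist_eq_norm]
      linarith [dist_triangle_left (F p.1 z) (F p.2 z) (f z)]
    · rw [div_lt_iff₀ hR]
      linarith [mul_pos hε hR]
  choose! g' hg' using fun y (hy : y ∈ ball x R) =>
    CompleteSpace.complete (hcauchy.cauchy_map hy)
  have hlim : TendstoUniformlyOnFilter (fun j => fderiv ℂ (F j)) g' l (𝓝 x) :=
    (hcauchy.tendstoUniformlyOn_of_tendsto fun y hy => hg' y hy).tendstoUniformlyOnFilter.mono_right
      (le_principal_iff.2 (ball_mem_nhds x hR))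
  refine (hasFDerivAt_of_tendstoUniformlyOnFilter (f := F) hlim ?_ ?_).differentiableAt
  · filter_upwards [hdR.prod_mk (ball_mem_nhds x hR)] with p hp
    exact (hdat hp.1 _ hp.2).hasFDerivAt
  · filter_upwards [hs] with y hy
    exact hunif.tendsto_at hy

end Holomorphic

/-- The `L²` norm over an open set is the supremum of the `L²` norms over its compact subsets. -/
theorem eLpNorm_two_restrict_le_of_forall_isCompact {E : Type*} [NormedAddCommGroup E]
    [ProperSpace E] [MeasurableSpace E] [BorelSpace E] {μ : Measure E} {U : Set E} (hU : IsOpen U)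
    {f : E → ℂ} {A : ℝ≥0∞}
    (h : ∀ C : Set E, IsCompact C → C ⊆ U → eLpNorm f 2 (μ.restrict C) ≤ A) :
    eLpNorm f 2 (μ.restrict U) ≤ A := by
  obtain ⟨S, hSc, hSU, hS, hmono⟩ := hU.exists_iUnion_isClosed
  set T : ℕ → Set E := fun k => S k ∩ closedBall 0 k
  have hTmono : Monotone T := fun i j hij =>
    inter_subset_inter (hmono hij) (closedBall_subset_closedBall (by exact_mod_cast hij))
  have hT : ⋃ k, T k = U := by
    refine subset_antisymm (iUnion_subset fun k => inter_subset_left.trans (hSU k)) fun x hx => ?_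
    obtain ⟨i, hi⟩ := mem_iUnion.1 (hS.symm.subset hx)
    obtain ⟨k, hk⟩ := exists_nat_ge ‖x‖
    refine mem_iUnion.2 ⟨max i k, hmono (le_max_left _ _) hi, ?_⟩
    rw [mem_closedBall_zero_iff]
    exact hk.trans (by exact_mod_cast le_max_right i k)
  have hT' : ∀ k, eLpNorm f 2 (μ.restrict (T k)) ≤ A := fun k =>
    h _ ((isCompact_closedBall 0 (k : ℝ)).inter_left (hSc k)) (inter_subset_left.trans (hSU k))
  simp only [eLpNorm_eq_lintegral_rpow_enorm_toReal two_ne_zero ENNReal.ofNat_ne_top,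
    ENNReal.toReal_ofNat, one_div, ENNReal.rpow_inv_le_iff two_pos] at hT' ⊢
  rw [← hT, setLIntegral_iUnion_of_directed _ hTmono.directed_le]
  exact iSup_le hT'

/-- Lower semicontinuity of the `L²` norm under locally uniform convergence. -/
theorem eLpNorm_two_restrict_le_of_tendstoLocallyUniformlyOn {E : Type*} [NormedAddCommGroup E]
    [ProperSpace E] [MeasurableSpace E] [BorelSpace E] {μ : Measure E}
    [IsFiniteMeasureOnCompacts μ] {U : Set E} (hU : IsOpen U) {ι : Type*} {l : Filter ι} [l.NeBot]
    {F : ι → E → ℂ} {f : E → ℂ} (hlim : TendstoLocallyUniformlyOn F f l U)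
    (hf : ContinuousOn f U) {a : ι → ℝ≥0∞} {A : ℝ≥0∞} (ha : Tendsto a l (𝓝 A))
    (hF : ∀ C : Set E, IsCompact C → C ⊆ U →
      ∀ᶠ j in l, ContinuousOn (F j) C ∧ eLpNorm (F j) 2 (μ.restrict C) ≤ a j) :
    eLpNorm f 2 (μ.restrict U) ≤ A := by
  refine eLpNorm_two_restrict_le_of_forall_isCompact hU fun C hC hCU => ?_
  have hunif := (tendstoLocallyUniformlyOn_iff_tendstoUniformlyOn_of_compact hC).1
    (hlim.mono hCU)
  set V : ℝ≥0∞ := (μ.restrict C) univ ^ (2 : ℝ≥0∞).toReal⁻¹ with hV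
  have hVtop : V ≠ ⊤ := by
    rw [hV, Measure.restrict_apply_univ]
    exact ENNReal.rpow_ne_top_of_nonneg (by positivity) hC.measure_lt_top.ne
  have hbound : ∀ ε : ℝ, 0 < ε → eLpNorm f 2 (μ.restrict C) ≤ V * ENNReal.ofReal ε + A := by
    intro ε hε
    refine ge_of_tendsto (tendsto_const_nhds.add ha) ?_
    filter_upwards [hF C hC hCU, Metric.tendstoUniformlyOn_iff.1 hunif ε hε] with j hj hε
    have hFm := hj.1.aestronglyMeasurable (μ := μ) hC.measurableSet
    have hfm := (hf.mono hCU).aestronglyMeasurable (μ := μ) hC.measurableSet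
    calc eLpNorm f 2 (μ.restrict C) = eLpNorm ((f - F j) + F j) 2 (μ.restrict C) := by
          rw [sub_add_cancel]
      _ ≤ eLpNorm (f - F j) 2 (μ.restrict C) + eLpNorm (F j) 2 (μ.restrict C) :=
        eLpNorm_add_le (hfm.sub hFm) hFm one_le_two
      _ ≤ _ := by
        refine add_le_add (eLpNorm_le_of_ae_bound ?_) hj.2
        filter_upwards [ae_restrict_mem hC.measurableSet] with y hy
        rw [Pi.sub_apply, ← dist_eq_norm]
        exact (hε y hy).le
  have hlim0 : Tendsto (fun ε : ℝ => V * ENNReal.ofReal ε + A) (𝓝[>] 0) (𝓝 (V * 0 + A)) := by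
    refine Tendsto.add (ENNReal.Tendsto.const_mul ?_ (.inr hVtop)) tendsto_const_nhds
    rw [← ENNReal.ofReal_zero]
    exact (ENNReal.continuous_ofReal.tendsto 0).mono_left nhdsWithin_le_nhds
  rw [mul_zero, zero_add] at hlim0
  exact ge_of_tendsto hlim0 (eventually_mem_nhdsWithin.mono fun ε hε => hbound ε hε)

section Convergence

variable {n : ℕ}

theorem IsBergmanKernel.norm_toLp_eq_sqrt {Ω : Set (Fin n → ℂ)}
    {K : (Fin n → ℂ) → (Fin n → ℂ) → ℂ} (hK : IsBergmanKernel Ω K) {w : Fin n → ℂ} (hw : w ∈ Ω) :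
    ‖hK.toLp hw‖ = √(K w w).re := by
  rw [hK.diag_eq hw, Complex.ofReal_re, Real.sqrt_sq (norm_nonneg _)]

theorem IsBergmanKernel.eLpNorm_eq {Ω : Set (Fin n → ℂ)}
    {K : (Fin n → ℂ) → (Fin n → ℂ) → ℂ} (hK : IsBergmanKernel Ω K) {w : Fin n → ℂ} (hw : w ∈ Ω) :
    eLpNorm (fun z => K z w) 2 (volume.restrict Ω) = ENNReal.ofReal √(K w w).re := by
  rw [← hK.norm_toLp_eq_sqrt hw, IsBergmanKernel.toLp, Lp.norm_toLp,
    ENNReal.ofReal_toReal (hK.1 w hw).2.eLpNorm_ne_top]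

/-- Kernels are bounded on balls, uniformly over all open sets containing a larger ball. -/
theorem exists_forall_norm_kernel_le (n : ℕ) {r : ℝ} (hr : 0 < r) :
    ∃ C : ℝ, ∀ (Ω : Set (Fin n → ℂ)) (K : (Fin n → ℂ) → (Fin n → ℂ) → ℂ), IsOpen Ω →
      IsBergmanKernel Ω K → ∀ z w, closedBall z r ⊆ Ω → closedBall w r ⊆ Ω → ‖K z w‖ ≤ C := by
  obtain ⟨C, hC⟩ := exists_forall_norm_toLp_le n hr
  refine ⟨C * C, fun Ω K hΩ hK z w hz hw => ?_⟩
  have hz' : z ∈ Ω := hz (mem_closedBall_self hr.le)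
  have hw' : w ∈ Ω := hw (mem_closedBall_self hr.le)
  have h₁ := hC Ω hΩ.measurableSet K hK z hz' hz
  have h₂ := hC Ω hΩ.measurableSet K hK w hw' hw
  exact (hK.norm_le hz' hw').trans
    (mul_le_mul h₁ h₂ (norm_nonneg _) ((norm_nonneg _).trans h₁))

theorem tendsto_bergmanKernel {Ω : ℕ → Set (Fin n → ℂ)} {Ωl : Set (Fin n → ℂ)}
    (hopen : ∀ j, IsOpen (Ω j)) (hopenl : IsOpen Ωl)
    (hsub : ∀ S : Set (Fin n → ℂ), IsCompact S → S ⊆ Ωl → ∀ᶠ j in atTop, S ⊆ Ω j)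
    {Kj : ℕ → (Fin n → ℂ) → (Fin n → ℂ) → ℂ} (hKj : ∀ j, IsBergmanKernel (Ω j) (Kj j))
    {Kl : (Fin n → ℂ) → (Fin n → ℂ) → ℂ} (hKl : IsBergmanKernel Ωl Kl)
    (hdiag : ∀ z ∈ Ωl, Tendsto (fun j => Kj j z z) atTop (𝓝 (Kl z z)))
    {z w : Fin n → ℂ} (hz : z ∈ Ωl) (hw : w ∈ Ωl) :
    Tendsto (fun j => Kj j z w) atTop (𝓝 (Kl z w)) := by
  have hball : ∀ x ∈ Ωl, ∃ r > 0, closedBall x r ⊆ Ωl := fun x hx =>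
    nhds_basis_closedBall.mem_iff.1 (hopenl.mem_nhds hx)
  have hbound : ∀ x ∈ Ωl, ∃ r > 0, ∃ M : ℝ, ∀ᶠ j in atTop,
      DifferentiableOn ℂ (fun u => Kj j u w) (ball x r) ∧ ∀ u ∈ ball x r, ‖Kj j u w‖ ≤ M := by
    intro x hx
    obtain ⟨r₁, hr₁, h₁⟩ := hball x hx
    obtain ⟨r₂, hr₂, h₂⟩ := hball w hw
    have hr : 0 < min (r₁ / 2) r₂ := by positivity
    obtain ⟨C, hC⟩ := exists_forall_norm_kernel_le n hr
    refine ⟨min (r₁ / 2) r₂, hr, C, ?_⟩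
    have hle := min_le_left (r₁ / 2) r₂
    filter_upwards [hsub _ (isCompact_closedBall x r₁) h₁, hsub _ (isCompact_closedBall w r₂) h₂]
      with j hj₁ hj₂
    refine ⟨((hKj j).1 w (hj₂ (mem_closedBall_self hr₂.le))).1.mono
      ((ball_subset_closedBall.trans (closedBall_subset_closedBall (by linarith))).trans hj₁),
      fun u hu => hC _ _ (hopen j) (hKj j) u w ?_
        ((closedBall_subset_closedBall (min_le_right _ _)).trans hj₂)⟩
    rw [mem_ball] at hu
    exact (closedBall_subset_closedBall' (by linarith)).trans hj₁
  rw [tendsto_iff_ultrafilter]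
  intro 𝒰 h𝒰
  have hexists : ∀ x ∈ Ωl, ∃ y, Tendsto (fun j => Kj j x w) 𝒰 (𝓝 y) := by
    intro x hx
    obtain ⟨r, hr, M, hM⟩ := hbound x hx
    have hmem : ∀ᶠ j in (𝒰 : Filter ℕ), Kj j x w ∈ closedBall (0 : ℂ) M :=
      h𝒰 (hM.mono fun j hj => mem_closedBall_zero_iff.2 (hj.2 x (mem_ball_self hr)))
    obtain ⟨y, -, hy⟩ := (isCompact_iff_ultrafilter_le_nhds.1 (isCompact_closedBall (0 : ℂ) M))
      (𝒰.map fun j => Kj j x w) (le_principal_iff.2 hmem)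
    exact ⟨y, hy⟩
  choose! f hf using hexists
  have hunif : TendstoLocallyUniformlyOn (fun j u => Kj j u w) f 𝒰 Ωl := by
    refine tendstoLocallyUniformlyOn_of_locally_bounded (fun x hx => ?_) hf
    obtain ⟨r, hr, M, hM⟩ := hbound x hx
    exact ⟨r, hr, M, h𝒰 hM⟩
  have hfd : DifferentiableOn ℂ f Ωl := by
    refine differentiableOn_of_tendstoLocallyUniformlyOn hopenl (fun x hx => ?_) hunif
    obtain ⟨r, hr, M, hM⟩ := hbound x hx
    exact ⟨r, hr, h𝒰 (hM.mono fun j hj => hj.1)⟩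
  have hfn : eLpNorm f 2 (volume.restrict Ωl) ≤ ENNReal.ofReal √(Kl w w).re := by
    refine eLpNorm_two_restrict_le_of_tendstoLocallyUniformlyOn hopenl hunif hfd.continuousOn
      (a := fun j => ENNReal.ofReal √(Kj j w w).re) ?_ fun C hC hCΩ => ?_
    · exact ((ENNReal.continuous_ofReal.comp
        (Real.continuous_sqrt.comp Complex.continuous_re)).tendsto _).comp
        ((hdiag w hw).mono_left h𝒰)
    · refine h𝒰 ?_
      filter_upwards [hsub C hC hCΩ, hsub {w} isCompact_singleton (singleton_subset_iff.2 hw)]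
        with j hj hjw
      have hwj : w ∈ Ω j := hjw rfl
      refine ⟨((hKj j).1 w hwj).1.continuousOn.mono hj, ?_⟩
      rw [← (hKj j).eLpNorm_eq hwj]
      exact eLpNorm_mono_measure _ (Measure.restrict_mono_set _ hj)
  have hfA : MemA2 Ωl f := ⟨hfd, hfd.continuousOn.aestronglyMeasurable hopenl.measurableSet,
    hfn.trans_lt ENNReal.ofReal_lt_top⟩
  have hfw : f w = Kl w w := tendsto_nhds_unique (hf w hw) ((hdiag w hw).mono_left h𝒰)
  have hn : ‖hfA.2.toLp f‖ ≤ ‖hKl.toLp hw‖ := by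
    rw [hKl.norm_toLp_eq_sqrt hw, Lp.norm_toLp]
    exact ENNReal.toReal_le_of_le_ofReal (Real.sqrt_nonneg _) hfn
  rw [← hKl.eq_of_norm_le hfA hw hfw hn hz]
  exact hf z hz

end Convergence

section Family

variable {n : ℕ}

theorem IsBergmanKernel.continuousOn {Ω : Set (Fin n → ℂ)} {K : (Fin n → ℂ) → (Fin n → ℂ) → ℂ}
    (hΩ : IsOpen Ω) (hK : IsBergmanKernel Ω K) :
    ContinuousOn (fun p : (Fin n → ℂ) × (Fin n → ℂ) => K p.1 p.2) (Ω ×ˢ Ω) := by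
  intro p hp
  refine ContinuousAt.continuousWithinAt ?_
  have hball : ∀ x ∈ Ω, ∃ r > 0, closedBall x (2 * r) ⊆ Ω := fun x hx => by
    obtain ⟨r, hr, h⟩ := nhds_basis_closedBall.mem_iff.1 (hΩ.mem_nhds hx)
    exact ⟨r / 2, by positivity, by rwa [mul_div_cancel₀ _ two_ne_zero]⟩
  have hsub : ∀ {x : Fin n → ℂ} {r s : ℝ}, closedBall x (2 * r) ⊆ Ω → s ≤ r →
      ∀ u ∈ ball x r, closedBall u s ⊆ Ω := fun {x r s} h hs u hu => by
    rw [mem_ball] at hu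
    exact (closedBall_subset_closedBall' (by linarith)).trans h
  have hunif : TendstoLocallyUniformlyOn (fun (q : (Fin n → ℂ) × (Fin n → ℂ)) u => K u q.2)
      (fun u => K u p.2) (𝓝 p) Ω := by
    refine tendstoLocallyUniformlyOn_of_locally_bounded (fun z hz => ?_) fun z hz => ?_
    · obtain ⟨r₁, hr₁, h₁⟩ := hball z hz
      obtain ⟨r₂, hr₂, h₂⟩ := hball p.2 hp.2
      obtain ⟨C, hC⟩ := exists_forall_norm_kernel_le n (lt_min hr₁ hr₂)
      refine ⟨r₁, hr₁, C, ?_⟩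
      filter_upwards [continuousAt_snd.eventually (ball_mem_nhds p.2 hr₂)] with q hq
      refine ⟨(hK.1 q.2 (hsub h₂ le_rfl q.2 hq (mem_closedBall_self hr₂.le))).1.mono
        fun u hu => hsub h₁ le_rfl u hu (mem_closedBall_self hr₁.le), fun u hu => ?_⟩
      exact hC Ω K hΩ hK u q.2 (hsub h₁ (min_le_left _ _) u hu) (hsub h₂ (min_le_right _ _) q.2 hq)
    · have h : ContinuousAt (fun w => (starRingEnd ℂ) (K w z)) p.2 :=
        Complex.continuous_conj.continuousAt.comp
          ((hK.1 z hz).1.continuousOn.continuousAt (hΩ.mem_nhds hp.2))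
      have h' : ContinuousAt (fun w => K z w) p.2 := by
        refine h.congr ?_
        filter_upwards [hΩ.mem_nhds hp.2] with w hw using hK.conj_symm hz hw
      exact h'.tendsto.comp continuousAt_snd
  refine hunif.tendsto_comp ((hK.1 p.2 hp.2).1.continuousOn p.1 hp.1) hp.1 ?_
  rw [hΩ.nhdsWithin_eq hp.1]
  exact continuousAt_fst

/-- A mollifier reproducing holomorphic functions at `z` expresses `K(z, z)` as a smooth average of
the kernel. -/
theorem IsBergmanKernel.integral_prod_eq_diag {Ω : Set (Fin n → ℂ)}
    {K : (Fin n → ℂ) → (Fin n → ℂ) → ℂ} (hΩ : IsOpen Ω) (hK : IsBergmanKernel Ω K)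
    {B : Set (Fin n → ℂ)} (hB : IsCompact B) (hBΩ : B ⊆ Ω) {φ : (Fin n → ℂ) → ℂ}
    (hφ : Continuous φ) {z : Fin n → ℂ} (hz : z ∈ Ω)
    (hrep : ∀ f, DifferentiableOn ℂ f Ω → f z = ∫ u in B, f u * φ (u - z)) :
    ∫ y in B ×ˢ B, K y.1 y.2 • (φ (y.1 - z) * (starRingEnd ℂ) (φ (y.2 - z))) = K z z := by
  have hint : IntegrableOn (fun y : (Fin n → ℂ) × (Fin n → ℂ) =>
      K y.1 y.2 • (φ (y.1 - z) * (starRingEnd ℂ) (φ (y.2 - z)))) (B ×ˢ B)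
      (volume.prod volume) := by
    refine ContinuousOn.integrableOn_compact (hB.prod hB) (ContinuousOn.smul
      ((hK.continuousOn hΩ).mono (prod_mono hBΩ hBΩ)) (Continuous.continuousOn ?_))
    have := Complex.continuous_conj
    fun_prop
  rw [Measure.volume_eq_prod, setIntegral_prod _ hint, hrep _ (hK.1 z hz).1]
  refine setIntegral_congr_fun hB.measurableSet fun u hu => ?_
  have hu' := hBΩ hu
  calc ∫ v in B, K u v • (φ (u - z) * (starRingEnd ℂ) (φ (v - z)))
      = ∫ v in B, φ (u - z) * (starRingEnd ℂ) (K v u * φ (v - z)) := by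
        refine setIntegral_congr_fun hB.measurableSet fun v hv => ?_
        simp only [smul_eq_mul, map_mul, hK.conj_symm hu' (hBΩ hv)]
        ring
    _ = φ (u - z) * (starRingEnd ℂ) (K z u) := by
        rw [integral_const_mul, integral_conj, ← hrep _ (hK.1 u hu').1]
    _ = K u z * φ (u - z) := by rw [hK.conj_symm hu' hz, mul_comm]

variable {X : Type} [TopologicalSpace X] {x₀ : X}

theorem SmoothFamilyAt.wirtingerBar {z₀ : Fin n → ℂ} {m : ℕ} {F : X → (Fin n → ℂ) → ℂ}
    (h : SmoothFamilyAt x₀ z₀ (m + 1) F) (ν : Fin n) :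
    SmoothFamilyAt x₀ z₀ m (fun x z => wderivBar ν (F x) z) := by
  have := h.2.2.clm_comp ((2 : ℂ)⁻¹ • (ContinuousLinearMap.apply ℝ ℂ (Pi.single ν (1 : ℂ)) +
    Complex.I • ContinuousLinearMap.apply ℝ ℂ (Pi.single ν Complex.I)))
  refine this.congr (.of_forall fun p => ?_)
  simp only [wderivBar, smul_apply, add_apply,
    ContinuousLinearMap.apply_apply, smul_eq_mul]
  ring

theorem SmoothFamilyAt.wirtinger {z₀ : Fin n → ℂ} {m : ℕ} {F : X → (Fin n → ℂ) → ℂ}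
    (h : SmoothFamilyAt x₀ z₀ (m + 1) F) (μ : Fin n) :
    SmoothFamilyAt x₀ z₀ m (fun x z => wderiv μ (F x) z) := by
  have := h.2.2.clm_comp ((2 : ℂ)⁻¹ • (ContinuousLinearMap.apply ℝ ℂ (Pi.single μ (1 : ℂ)) -
    Complex.I • ContinuousLinearMap.apply ℝ ℂ (Pi.single μ Complex.I)))
  refine this.congr (.of_forall fun p => ?_)
  simp only [wderiv, smul_apply, sub_apply,
    ContinuousLinearMap.apply_apply, smul_eq_mul]
  ring

variable [FirstCountableTopology X]
  {Ω : X → Set (Fin n → ℂ)} {K : X → (Fin n → ℂ) → (Fin n → ℂ) → ℂ}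

theorem smoothFamilyAt_kernel_diag (hopen : ∀ x, IsOpen (Ω x))
    (hsub : ∀ S : Set (Fin n → ℂ), IsCompact S → S ⊆ Ω x₀ → ∀ᶠ x in 𝓝 x₀, S ⊆ Ω x)
    (hK : ∀ x, IsBergmanKernel (Ω x) (K x))
    (hcont : ∀ z ∈ Ω x₀, ∀ w ∈ Ω x₀, ContinuousAt (fun x => K x z w) x₀)
    {z₀ : Fin n → ℂ} (hz₀ : z₀ ∈ Ω x₀) (m : ℕ) :
    SmoothFamilyAt x₀ z₀ m (fun x z => K x z z) := by
  obtain ⟨ρ, hρ, hball⟩ := nhds_basis_closedBall.mem_iff.1 ((hopen x₀).mem_nhds hz₀)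
  obtain ⟨r, hr, rfl⟩ : ∃ r > 0, 3 * r = ρ := ⟨ρ / 3, by positivity, by ring⟩
  obtain ⟨φ, hφ, -, hrep⟩ := exists_reproducing_mollifier n hr
  obtain ⟨C, hC⟩ := exists_forall_norm_kernel_le n hr
  have hev := hsub _ (isCompact_closedBall z₀ (3 * r)) hball
  set B := closedBall z₀ (2 * r)
  have hBc : IsCompact B := isCompact_closedBall _ _
  have hBmem : ∀ y ∈ B, closedBall y r ⊆ closedBall z₀ (3 * r) := fun y hy =>
    closedBall_subset_closedBall' (by linarith [mem_closedBall.1 hy])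
  have hBsub : B ⊆ closedBall z₀ (3 * r) := closedBall_subset_closedBall (by linarith)
  have hBB : IsCompact (B ×ˢ B) := hBc.prod hBc
  have : IsFiniteMeasure (volume.restrict (B ×ˢ B)) := ⟨by
    rw [Measure.restrict_apply_univ]
    exact hBB.measure_lt_top⟩
  obtain ⟨R, hR⟩ := hBB.isBounded.exists_norm_le
  have hmem : ∀ᵐ y ∂(volume.restrict (B ×ˢ B)), y ∈ B ×ˢ B := ae_restrict_mem hBB.measurableSet
  have hΦ : ContDiff ℝ (⊤ : ℕ∞) fun q : (Fin n → ℂ) × ((Fin n → ℂ) × (Fin n → ℂ)) =>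
      φ (q.2.1 - q.1) * (starRingEnd ℂ) (φ (q.2.2 - q.1)) := by
    refine ContDiff.mul (hφ.comp (by fun_prop)) (Complex.conjCLE.contDiff.comp (hφ.comp ?_))
    fun_prop
  have h := SmoothFamilyAt.integral (hmem.mono hR) (x₀ := x₀) (k := fun x y => K x y.1 y.2)
    (C := C) ?_ ?_ ?_ hΦ z₀ m
  · refine h.congr ?_
    rw [nhds_prod_eq]
    filter_upwards [hev.prod_mk (ball_mem_nhds z₀ hr)] with p hp
    have hz : closedBall p.2 r ⊆ B :=
      closedBall_subset_closedBall' (by linarith [mem_ball.1 hp.2])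
    have hBΩ : B ⊆ Ω p.1 := hBsub.trans hp.1
    exact (hK p.1).integral_prod_eq_diag (hopen p.1) hBc hBΩ hφ.continuous
      (hBΩ (hz (mem_closedBall_self hr.le))) fun f hf =>
        hrep _ f hf p.2 (hz.trans hBΩ) B hBc.measurableSet hz
  · filter_upwards [hev] with x hx
    exact (((hK x).continuousOn (hopen x)).mono (prod_mono (hBsub.trans hx)
      (hBsub.trans hx))).aestronglyMeasurable hBB.measurableSet
  · filter_upwards [hev] with x hx
    filter_upwards [hmem] with y hy
    exact hC _ _ (hopen x) (hK x) _ _ ((hBmem _ hy.1).trans hx) ((hBmem _ hy.2).trans hx)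
  · filter_upwards [hmem] with y hy
    exact hcont _ (hball (hBsub hy.1)) _ (hball (hBsub hy.2))

end Family

theorem tendstoLocallyUniformlyOn_of_continuousAt_infty {E G : Type*} [TopologicalSpace E]
    [UniformSpace G] {F : OnePoint ℕ → E → G} {U : Set E}
    (h : ∀ z ∈ U, ContinuousAt (fun p : OnePoint ℕ × E => F p.1 p.2) (OnePoint.infty, z)) :
    TendstoLocallyUniformlyOn (fun j : ℕ => F j) (F OnePoint.infty) atTop U := by
  rw [tendstoLocallyUniformlyOn_iff_forall_tendsto]
  intro z hz
  have hcoe : Tendsto (fun j : ℕ => (j : OnePoint ℕ)) atTop (𝓝 OnePoint.infty) := by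
    rw [← Nat.cofinite_eq_atTop, ← cocompact_eq_cofinite, ← coclosedCompact_eq_cocompact]
    exact OnePoint.tendsto_coe_infty
  have h₁ : Tendsto (fun y : ℕ × E => F y.1 y.2) (atTop ×ˢ 𝓝[U] z) (𝓝 (F OnePoint.infty z)) := by
    refine (h z hz).tendsto.comp (f := fun y : ℕ × E => ((y.1 : OnePoint ℕ), y.2)) ?_
    rw [nhds_prod_eq]
    exact hcoe.prodMap (tendsto_id.mono_left nhdsWithin_le_nhds)
  have h₂ : Tendsto (fun y : ℕ × E => F OnePoint.infty y.2) (atTop ×ˢ 𝓝[U] z)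
      (𝓝 (F OnePoint.infty z)) := by
    refine (h z hz).tendsto.comp
      (f := fun y : ℕ × E => ((OnePoint.infty : OnePoint ℕ), y.2)) ?_
    rw [nhds_prod_eq]
    exact tendsto_const_nhds.prodMk (tendsto_snd.mono_right nhdsWithin_le_nhds)
  exact (h₂.prodMk_nhds h₁).mono_right (nhds_le_uniformity _)

/-- stability of the Bergman metric tensors (with all derivatives) for a
sequence of domains converging in the local Hausdorff sense. -/
theorem bergman_tensor_stability {n : ℕ} (Ω : ℕ → Set (Fin n → ℂ)) (Ωl : Set (Fin n → ℂ))
    (hopen : ∀ j, IsOpen (Ω j)) (hopenl : IsOpen Ωl)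
    (hconv : LocalHausdorffConv Ω Ωl)
    (Kj : ℕ → (Fin n → ℂ) → (Fin n → ℂ) → ℂ) (hKj : ∀ j, IsBergmanKernel (Ω j) (Kj j))
    (Kl : (Fin n → ℂ) → (Fin n → ℂ) → ℂ) (hKl : IsBergmanKernel Ωl Kl)
    (hKjpos : ∀ j, DiagPos (Ω j) (Kj j)) (hKlpos : DiagPos Ωl Kl)
    (hdiag : ∀ z ∈ Ωl, Filter.Tendsto (fun j => Kj j z z) Filter.atTop (nhds (Kl z z))) :
    ∀ μ ν : Fin n,
      TendstoLocallyUniformlyOn (fun j => bergmanTensor (Kj j) μ ν)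
        (bergmanTensor Kl μ ν) Filter.atTop Ωl ∧
      ∀ d : ℕ, TendstoLocallyUniformlyOn
        (fun j => iteratedFDeriv ℝ d (bergmanTensor (Kj j) μ ν))
        (iteratedFDeriv ℝ d (bergmanTensor Kl μ ν)) Filter.atTop Ωl := by
  intro μ ν
  set Ω' : OnePoint ℕ → Set (Fin n → ℂ) := fun x => x.elim Ωl Ω
  set K' : OnePoint ℕ → (Fin n → ℂ) → (Fin n → ℂ) → ℂ := fun x => x.elim Kl Kj
  have hatTop : coclosedCompact ℕ = atTop := by
    rw [coclosedCompact_eq_cocompact, cocompact_eq_cofinite, Nat.cofinite_eq_atTop]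
  have hsmooth : ∀ z ∈ Ωl, ∀ m,
      SmoothFamilyAt OnePoint.infty z m fun x => bergmanTensor (K' x) μ ν := by
    intro z hz m
    have hdiagSmooth : SmoothFamilyAt OnePoint.infty z (m + 1 + 1) fun x u => K' x u u := by
      refine smoothFamilyAt_kernel_diag (Ω := Ω') (fun x => ?_) (fun S hS hSΩ => ?_) (fun x => ?_)
        (fun u hu w hw => ?_) hz _
      · cases x
        exacts [hopenl, hopen _]
      · rw [OnePoint.nhds_infty_eq, hatTop, eventually_sup, eventually_map, eventually_pure]
        exact ⟨hconv.1 S hS hSΩ, hSΩ⟩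
      · cases x
        exacts [hKl, hKj _]
      · rw [OnePoint.continuousAt_infty', hatTop]
        exact tendsto_bergmanKernel hopen hopenl hconv.1 hKj hKl hdiag hu hw
    exact ((hdiagSmooth.clog (.inl (hKlpos z hz).2)).wirtingerBar ν).wirtinger μ
  exact ⟨tendstoLocallyUniformlyOn_of_continuousAt_infty
      (F := fun x => bergmanTensor (K' x) μ ν) fun z hz => (hsmooth z hz 0).continuousAt,
    fun d => tendstoLocallyUniformlyOn_of_continuousAt_infty
      (F := fun x => iteratedFDeriv ℝ d (bergmanTensor (K' x) μ ν))
      fun z hz => (hsmooth z hz d).continuousAt_iteratedFDeriv⟩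

end
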